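/- The ℂ-algebra R₃ = ℂ[z₁,z₃,z₅,z₆,b₁,b₂,b₆]/J, where J is the ideal generated by the five polynomials 4z₁b₁ + q z₃b₂ + z₅b₆, z₁z₅ + z₃b₁ + q z₆b₆, z₁²b₆ - z₃b₆² - 4q b₁² - 3z₅b₂, z₁²z₃ - z₃²b₆ - q z₅² - 12z₆b₁, and z₁³ - z₁z₃b₆ + q z₅b₁ + 3q z₆b₂, is isomorphic as a ℂ-algebra to the ring of S₃-invariants of ℂ[x₁,x₂,x₃,y₁,y₂,y₃]/(x₁+x₂+x₃, y₁+y₂+y₃), where S₃ acts by simultaneously permuting (x₁,x₂,x₃) and (y₁,y₂,y₃); that is, Spec(R₃) is isomorphic to the symplectic quotient singularity (𝔥₃ ⊕ 𝔥₃*)/S₃ of Coxeter type A₂. -/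

import Mathlib

/-!
STATEMENT 16: The ℂ-algebra R₃ = ℂ[z₁,z₃,z₅,z₆,b₁,b₂,b₆]/J, where J is generated
by the five polynomials of Table 4, is isomorphic as a ℂ-algebra to the ring of
S₃-invariants of ℂ[x₁,x₂,x₃,y₁,y₂,y₃]/(x₁+x₂+x₃, y₁+y₂+y₃), where S₃ acts by
simultaneously permuting (x₁,x₂,x₃) and (y₁,y₂,y₃); that is, Spec(R₃) is
isomorphic to the symplectic quotient singularity (𝔥₃ ⊕ 𝔥₃*)/S₃ of Coxeter
type A₂.

We realise ℂ[x₁,x₂,x₃,y₁,y₂,y₃] as `MvPolynomial (Fin 3 × Fin 2) ℂ`, with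
xᵢ = X (i, 0) and yᵢ = X (i, 1); the action of σ ∈ S₃ on the quotient ring is a
family of ℂ-algebra automorphisms ρ σ sending X (i, j) ↦ X (σ i, j); the
isomorphism of R₃ with the invariant subring is expressed by an injective
ℂ-algebra homomorphism ψ : R₃ → A whose range is exactly the set of fixed points.
In `R₃` the variables z₁,z₃,z₅,z₆,b₁,b₂,b₆ are X 0,…,X 6.
-/

noncomputable section

open MvPolynomial

/-- ω = e^{2πi/3} -/
noncomputable def ω : ℂ := Complex.exp (2 * Real.pi * Complex.I / 3)

/-- q = 2ω+1, a square root of -3 -/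
noncomputable def q : ℂ := 2 * ω + 1

/-- the ideal J of Table 4, with z₁,z₃,z₅,z₆,b₁,b₂,b₆ = X 0,…,X 6 -/
noncomputable def Jideal : Ideal (MvPolynomial (Fin 7) ℂ) :=
  Ideal.span
    {4 * X 0 * X 4 + C q * X 1 * X 5 + X 2 * X 6,
     X 0 * X 2 + X 1 * X 4 + C q * X 3 * X 6,
     X 0 ^ 2 * X 6 - X 1 * X 6 ^ 2 - C (4 * q) * X 4 ^ 2 - 3 * X 2 * X 5,
     X 0 ^ 2 * X 1 - X 1 ^ 2 * X 6 - C q * X 2 ^ 2 - 12 * X 3 * X 4,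
     X 0 ^ 3 - X 0 * X 1 * X 6 + C q * X 2 * X 4 + C (3 * q) * X 3 * X 5}

/-- the chart R₃ of the blow-up -/
noncomputable def R₃ : Type := MvPolynomial (Fin 7) ℂ ⧸ Jideal

noncomputable instance : CommRing R₃ := Ideal.Quotient.commRing Jideal
noncomputable instance : Algebra ℂ R₃ := Ideal.Quotient.algebra ℂ

/-- the coordinate ring of 𝔥₃ ⊕ 𝔥₃*, i.e.
ℂ[x₁,x₂,x₃,y₁,y₂,y₃]/(x₁+x₂+x₃, y₁+y₂+y₃), where xᵢ = X (i,0) and yᵢ = X (i,1) -/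
noncomputable def A : Type :=
  MvPolynomial (Fin 3 × Fin 2) ℂ ⧸
    (Ideal.span {∑ i : Fin 3, X (i, (0 : Fin 2)), ∑ i : Fin 3, X (i, (1 : Fin 2))} :
      Ideal (MvPolynomial (Fin 3 × Fin 2) ℂ))

noncomputable instance : CommRing A := Ideal.Quotient.commRing _
noncomputable instance : Algebra ℂ A := Ideal.Quotient.algebra ℂ

set_option linter.unusedSimpArgs false

lemma omega_rel : ω ^ 2 + ω + 1 = 0 := by
  have h : IsPrimitiveRoot ω 3 := by
    have := Complex.isPrimitiveRoot_exp 3 (by norm_num)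
    simpa [ω] using this
  have h3 : ω ^ 3 = 1 := h.pow_eq_one
  have h1 : ω ≠ 1 := h.ne_one (by norm_num)
  have : (ω - 1) * (ω ^ 2 + ω + 1) = 0 := by linear_combination h3
  rcases mul_eq_zero.mp this with h | h
  · exact absurd (sub_eq_zero.mp h) h1
  · exact h

lemma q_sq : q ^ 2 = -3 := by
  unfold q
  linear_combination 4 * omega_rel

lemma q_ne : q ≠ 0 := by
  intro h
  have := q_sq
  rw [h] at this
  norm_num at this

/-- membership in the span of `1, z₁, z₅, b₁, z₁², z₁³` over the image of `φ` -/
def InM {R : Type*} [CommRing R] [Algebra ℂ R] (φ : MvPolynomial (Fin 4) ℂ →ₐ[ℂ] R)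
    (z1 z5 b1 : R) (r : R) : Prop :=
  ∃ f0 f1 f2 f3 f4 f5 : MvPolynomial (Fin 4) ℂ,
    r = φ f0 + φ f1 * z1 + φ f2 * z5 + φ f3 * b1 + φ f4 * z1 ^ 2 + φ f5 * z1 ^ 3

section span
variable {R : Type*} [CommRing R] [Algebra ℂ R] {φ : MvPolynomial (Fin 4) ℂ →ₐ[ℂ] R}
  {z1 z5 b1 : R}

lemma InM.add {r s : R} (hr : InM φ z1 z5 b1 r) (hs : InM φ z1 z5 b1 s) :
    InM φ z1 z5 b1 (r + s) := by
  obtain ⟨f0, f1, f2, f3, f4, f5, rfl⟩ := hr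
  obtain ⟨g0, g1, g2, g3, g4, g5, rfl⟩ := hs
  refine ⟨f0 + g0, f1 + g1, f2 + g2, f3 + g3, f4 + g4, f5 + g5, ?_⟩
  simp only [map_add]
  ring

lemma InM.mul {r : R} (g : MvPolynomial (Fin 4) ℂ) (hr : InM φ z1 z5 b1 r) :
    InM φ z1 z5 b1 (φ g * r) := by
  obtain ⟨f0, f1, f2, f3, f4, f5, rfl⟩ := hr
  refine ⟨g * f0, g * f1, g * f2, g * f3, g * f4, g * f5, ?_⟩
  simp only [map_mul]
  ring

/-- multiplication by an element preserves the span if it maps the basis into it -/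
lemma InM.mul_of {t : R} (h0 : InM φ z1 z5 b1 t) (h1 : InM φ z1 z5 b1 (t * z1))
    (h2 : InM φ z1 z5 b1 (t * z5)) (h3 : InM φ z1 z5 b1 (t * b1))
    (h4 : InM φ z1 z5 b1 (t * z1 ^ 2)) (h5 : InM φ z1 z5 b1 (t * z1 ^ 3))
    {r : R} (hr : InM φ z1 z5 b1 r) : InM φ z1 z5 b1 (t * r) := by
  obtain ⟨f0, f1, f2, f3, f4, f5, rfl⟩ := hr
  have := (((((h0.mul f0).add (h1.mul f1)).add (h2.mul f2)).add (h3.mul f3)).add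
    (h4.mul f4)).add (h5.mul f5)
  convert this using 1
  ring

/-- the five relations show that the span is everything -/
lemma span_all (v : Fin 7 → R) (Q : R) (hQ : Q = algebraMap ℂ R q)
    (e1 : 4 * v 0 * v 4 + Q * v 1 * v 5 + v 2 * v 6 = 0)
    (e2 : v 0 * v 2 + v 1 * v 4 + Q * v 3 * v 6 = 0)
    (e3 : v 0 ^ 2 * v 6 - v 1 * v 6 ^ 2 - 4 * Q * v 4 ^ 2 - 3 * v 2 * v 5 = 0)
    (e4 : v 0 ^ 2 * v 1 - v 1 ^ 2 * v 6 - Q * v 2 ^ 2 - 12 * v 3 * v 4 = 0)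
    (e5 : v 0 ^ 3 - v 0 * v 1 * v 6 + Q * v 2 * v 4 + 3 * Q * v 3 * v 5 = 0)
    (p : MvPolynomial (Fin 7) ℂ) :
    InM (aeval ![v 1, v 3, v 6, v 5]) (v 0) (v 2) (v 4) (aeval v p) := by
  set φ : MvPolynomial (Fin 4) ℂ →ₐ[ℂ] R := aeval ![v 1, v 3, v 6, v 5] with hφ
  have p0 : φ (X 0) = v 1 := by simp [hφ]
  have p1 : φ (X 1) = v 3 := by simp [hφ]
  have p2 : φ (X 2) = v 6 := by simp [hφ]
  have p3 : φ (X 3) = v 5 := by simp [hφ]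
  have pC : ∀ c : ℂ, φ (C c) = algebraMap ℂ R c := fun c => by simp [hφ]
  have pq : φ (C q) = Q := by rw [pC, hQ]
  have hQ2 : Q ^ 2 = -3 := by
    rw [hQ, ← map_pow, q_sq, map_neg]; exact congrArg Neg.neg (map_ofNat (algebraMap ℂ R) 3)
  obtain ⟨T, hT⟩ : ∃ T : R, T = algebraMap ℂ R (1 / 12) := ⟨_, rfl⟩
  have pT : φ (C (1 / 12)) = T := by rw [pC, hT]
  have hT12 : 12 * T = 1 := by
    rw [hT, show (12 : R) = algebraMap ℂ R 12 from (map_ofNat (algebraMap ℂ R) 12).symm, ← map_mul]; norm_num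
  -- basis products
  have c0 : InM φ (v 0) (v 2) (v 4) 1 := ⟨1, 0, 0, 0, 0, 0, by simp⟩
  have cz1 : InM φ (v 0) (v 2) (v 4) (v 0) := ⟨0, 1, 0, 0, 0, 0, by simp⟩
  have cz5 : InM φ (v 0) (v 2) (v 4) (v 2) := ⟨0, 0, 1, 0, 0, 0, by simp⟩
  have cb1 : InM φ (v 0) (v 2) (v 4) (v 4) := ⟨0, 0, 0, 1, 0, 0, by simp⟩
  have cz12 : InM φ (v 0) (v 2) (v 4) (v 0 ^ 2) := ⟨0, 0, 0, 0, 1, 0, by simp⟩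
  have cz13 : InM φ (v 0) (v 2) (v 4) (v 0 ^ 3) := ⟨0, 0, 0, 0, 0, 1, by simp⟩
  have d1 : InM φ (v 0) (v 2) (v 4) (v 0 * v 4) := by
    refine ⟨-3 * C (1 / 12) * C q * X 0 * X 3, 0, -3 * C (1 / 12) * X 2, 0, 0, 0, ?_⟩
    simp only [map_mul, map_neg, map_ofNat, map_zero, p0, p1, p2, p3, pq, pT]
    linear_combination (3 * T) * e1 - (v 0 * v 4) * hT12
  have d2 : InM φ (v 0) (v 2) (v 4) (v 0 * v 2) := by
    refine ⟨- C q * X 1 * X 2, 0, 0, - X 0, 0, 0, ?_⟩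
    simp only [map_mul, map_neg, map_ofNat, map_zero, p0, p1, p2, p3, pq, pT]
    linear_combination e2
  have d3 : InM φ (v 0) (v 2) (v 4) (v 4 * v 4) := by
    -- b₁² = -(Q/12) (z₁² b₆ - z₃ b₆² - 3 z₅ b₂)
    refine ⟨C (1 / 12) * C q * X 0 * X 2 ^ 2, 0, 3 * C (1 / 12) * C q * X 3, 0,
      -C (1 / 12) * C q * X 2, 0, ?_⟩
    simp only [map_mul, map_neg, map_pow, map_ofNat, map_zero, p0, p1, p2, p3, pq, pT]
    linear_combination (Q * T) * e3 - (v 4 ^ 2) * hT12 + 4 * T * v 4 ^ 2 * hQ2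
  have d4 : InM φ (v 0) (v 2) (v 4) (v 2 * v 2) := by
    -- z₅² = -(Q/3) (z₁² z₃ - z₃² b₆ - 12 z₆ b₁)
    refine ⟨4 * C (1 / 12) * C q * X 0 ^ 2 * X 2, 0, 0, 48 * C (1 / 12) * C q * X 1,
      -4 * C (1 / 12) * C q * X 0, 0, ?_⟩
    simp only [map_mul, map_neg, map_pow, map_ofNat, map_zero, p0, p1, p2, p3, pq, pT]
    linear_combination (4 * Q * T) * e4 - (v 2 ^ 2) * hT12 + 4 * T * v 2 ^ 2 * hQ2
  have d5 : InM φ (v 0) (v 2) (v 4) (v 2 * v 4) := by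
    -- z₅ b₁ = (Q/3) (z₁³ - z₁ z₃ b₆ + 3 Q z₆ b₂)
    refine ⟨12 * C (1 / 12) * C q * C q * X 1 * X 3, -4 * C (1 / 12) * C q * X 0 * X 2, 0, 0, 0,
      4 * C (1 / 12) * C q, ?_⟩
    simp only [map_mul, map_neg, map_pow, map_ofNat, map_zero, p0, p1, p2, p3, pq, pT]
    linear_combination -(4 * Q * T) * e5 - (v 2 * v 4) * hT12 + 4 * T * v 2 * v 4 * hQ2
  have d6 : InM φ (v 0) (v 2) (v 4) (v 0 * v 0 ^ 3) := by
    have t := ((cz12.mul (X 0 * X 2)).add (d3.mul (C q * X 0))).add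
      ((cb1.mul (C q * C q * X 1 * X 2)).add (cz1.mul (-3 * C q * X 1 * X 3)))
    convert t using 1
    simp only [map_mul, map_neg, map_pow, map_ofNat, map_zero, p0, p1, p2, p3, pq, pT]
    linear_combination (v 0) * e5 - Q * v 4 * e2
  have m1 : ∀ r, InM φ (v 0) (v 2) (v 4) r → InM φ (v 0) (v 2) (v 4) (v 0 * r) := by
    intro r hr
    refine InM.mul_of cz1 ?_ d2 d1 ?_ d6 hr
    · rw [← pow_two]; exact cz12
    · rw [← pow_succ']; exact cz13
  have m2 : ∀ r, InM φ (v 0) (v 2) (v 4) r → InM φ (v 0) (v 2) (v 4) (v 2 * r) := by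
    intro r hr
    refine InM.mul_of cz5 ?_ d4 d5 ?_ ?_ hr
    · rw [mul_comm]; exact d2
    · convert m1 _ d2 using 1; ring
    · convert m1 _ (m1 _ d2) using 1; ring
  have m3 : ∀ r, InM φ (v 0) (v 2) (v 4) r → InM φ (v 0) (v 2) (v 4) (v 4 * r) := by
    intro r hr
    refine InM.mul_of cb1 ?_ ?_ d3 ?_ ?_ hr
    · rw [mul_comm]; exact d1
    · rw [mul_comm]; exact d5
    · convert m1 _ d1 using 1; ring
    · convert m1 _ (m1 _ d1) using 1; ring
  induction p using MvPolynomial.induction_on with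
  | C a => exact ⟨C a, 0, 0, 0, 0, 0, by simp [pC]⟩
  | add p r hp hr => rw [map_add]; exact hp.add hr
  | mul_X p i hp =>
    rw [map_mul, aeval_X, mul_comm]
    fin_cases i
    · exact m1 _ hp
    · have := hp.mul (X 0); rwa [p0] at this
    · exact m2 _ hp
    · have := hp.mul (X 1); rwa [p1] at this
    · exact m3 _ hp
    · have := hp.mul (X 3); rwa [p3] at this
    · have := hp.mul (X 2); rwa [p2] at this
end span

/-- pointwise independence of the six basis elements -/
lemma indep_pt (u v s t f0 f1 f2 f3 f4 f5 : ℂ)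
    (hf : ∀ u' v' : ℂ, u' * v' = u * v → u' ^ 3 + v' ^ 3 = u ^ 3 + v ^ 3 →
      f0 + f1 * (u' * t + v' * s) + f2 * (u' ^ 2 * s + v' ^ 2 * t) + f3 * (u' * s ^ 2 + v' * t ^ 2)
        + f4 * (u' * t + v' * s) ^ 2 + f5 * (u' * t + v' * s) ^ 3 = 0)
    (hu : u ^ 3 - v ^ 3 ≠ 0) (hs : s ^ 3 - t ^ 3 ≠ 0) :
    f0 = 0 ∧ f1 = 0 ∧ f2 = 0 ∧ f3 = 0 ∧ f4 = 0 ∧ f5 = 0 := by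
  have w := omega_rel
  have w3 : ω ^ 3 = 1 := by linear_combination (ω - 1) * w
  have key : ∀ a b : ℂ, a * b = u * v → a ^ 3 + b ^ 3 = u ^ 3 + v ^ 3 →
      (f0 + 2 * a * b * s * t * f4 + (a ^ 3 * t ^ 3 + b ^ 3 * s ^ 3) * f5 = 0) ∧
      (f1 * a * t + f2 * b ^ 2 * t + f3 * a * s ^ 2 + f4 * b ^ 2 * s ^ 2
        + 3 * f5 * a ^ 2 * b * s * t ^ 2 = 0) ∧
      (f1 * b * s + f2 * a ^ 2 * s + f3 * b * t ^ 2 + f4 * a ^ 2 * t ^ 2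
        + 3 * f5 * b ^ 2 * a * t * s ^ 2 = 0) := by
    intro a b h1 h2
    have E0 := hf a b h1 h2
    have E1 := hf (ω * a) (ω ^ 2 * b) (by linear_combination (a * b) * w3 + h1)
      (by linear_combination (a ^ 3 + b ^ 3 * (ω ^ 3 + 1)) * w3 + h2)
    have E2 := hf (ω ^ 2 * a) (ω * b) (by linear_combination (a * b) * w3 + h1)
      (by linear_combination (b ^ 3 + a ^ 3 * (ω ^ 3 + 1)) * w3 + h2)
    obtain ⟨A0, hA0⟩ : ∃ A0, A0 = f0 + 2 * a * b * s * t * f4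
      + (a ^ 3 * t ^ 3 + b ^ 3 * s ^ 3) * f5 := ⟨_, rfl⟩
    obtain ⟨A1, hA1⟩ : ∃ A1, A1 = f1 * a * t + f2 * b ^ 2 * t + f3 * a * s ^ 2
      + f4 * b ^ 2 * s ^ 2 + 3 * f5 * a ^ 2 * b * s * t ^ 2 := ⟨_, rfl⟩
    obtain ⟨A2, hA2⟩ : ∃ A2, A2 = f1 * b * s + f2 * a ^ 2 * s + f3 * b * t ^ 2
      + f4 * a ^ 2 * t ^ 2 + 3 * f5 * b ^ 2 * a * t * s ^ 2 := ⟨_, rfl⟩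
    have w4 : ω ^ 4 = ω := by linear_combination ω * w3
    have w5 : ω ^ 5 = ω ^ 2 := by linear_combination ω ^ 2 * w3
    have w6 : ω ^ 6 = 1 := by linear_combination (ω ^ 3 + 1) * w3
    have G0 : A0 + A1 + A2 = 0 := by rw [hA0, hA1, hA2]; linear_combination E0
    have G1 : A0 + ω * A1 + ω ^ 2 * A2 = 0 := by
      rw [hA0, hA1, hA2]
      ring_nf at E1 ⊢
      simp only [w3, w4, w5, w6] at E1 ⊢
      linear_combination E1
    have G2 : A0 + ω ^ 2 * A1 + ω * A2 = 0 := by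
      rw [hA0, hA1, hA2]
      ring_nf at E2 ⊢
      simp only [w3, w4, w5, w6] at E2 ⊢
      linear_combination E2
    rw [← hA0, ← hA1, ← hA2]
    refine ⟨?_, ?_, ?_⟩
    · linear_combination (G0 + G1 + G2) / 3 - (A1 + A2) / 3 * w
    · linear_combination (G0 + ω ^ 2 * G1 + ω * G2) / 3 - (A0 + A2) / 3 * w
        - (2 * A1 + A2 * ω) / 3 * w3
    · linear_combination (G0 + ω * G1 + ω ^ 2 * G2) / 3 - (A0 + A1) / 3 * w
        - (2 * A2 + A1 * ω) / 3 * w3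
  obtain ⟨a0, a1, a2⟩ := key u v rfl rfl
  obtain ⟨b0, b1, b2⟩ := key v u (mul_comm _ _) (add_comm _ _)
  have h5 : f5 = 0 := by
    have : f5 * ((u ^ 3 - v ^ 3) * (s ^ 3 - t ^ 3)) = 0 := by linear_combination b0 - a0
    simpa [hu, hs] using this
  subst h5
  have g1 : f3 * u + f4 * v ^ 2 = 0 := by
    have : (f3 * u + f4 * v ^ 2) * (s ^ 3 - t ^ 3) = 0 := by
      linear_combination s * a1 - t * b2
    simpa [hs] using this
  have g2 : f3 * v + f4 * u ^ 2 = 0 := by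
    have : (f3 * v + f4 * u ^ 2) * (s ^ 3 - t ^ 3) = 0 := by
      linear_combination s * b1 - t * a2
    simpa [hs] using this
  have g3 : f1 * u + f2 * v ^ 2 = 0 := by
    have : (f1 * u + f2 * v ^ 2) * (s ^ 3 - t ^ 3) = 0 := by
      linear_combination s ^ 2 * b2 - t ^ 2 * a1
    simpa [hs] using this
  have g4 : f1 * v + f2 * u ^ 2 = 0 := by
    have : (f1 * v + f2 * u ^ 2) * (s ^ 3 - t ^ 3) = 0 := by
      linear_combination s ^ 2 * a2 - t ^ 2 * b1
    simpa [hs] using this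
  have h4 : f4 = 0 := by
    have : f4 * (u ^ 3 - v ^ 3) = 0 := by linear_combination u * g2 - v * g1
    simpa [hu] using this
  have h3 : f3 = 0 := by
    have : f3 * (u ^ 3 - v ^ 3) = 0 := by linear_combination u ^ 2 * g1 - v ^ 2 * g2
    simpa [hu] using this
  have h2 : f2 = 0 := by
    have : f2 * (u ^ 3 - v ^ 3) = 0 := by linear_combination u * g4 - v * g3
    simpa [hu] using this
  have h1 : f1 = 0 := by
    have : f1 * (u ^ 3 - v ^ 3) = 0 := by linear_combination u ^ 2 * g3 - v ^ 2 * g4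
    simpa [hu] using this
  subst h4
  refine ⟨?_, h1, h2, h3, rfl, rfl⟩
  simpa using a0

/-- the pair `(uv, u³+v³)` takes all values -/
lemma exists_uv (a b : ℂ) : ∃ u v : ℂ, u * v = a ∧ u ^ 3 + v ^ 3 = b := by
  obtain ⟨d, hd⟩ := IsAlgClosed.exists_pow_nat_eq (b ^ 2 - 4 * a ^ 3) (n := 2) (by norm_num)
  obtain ⟨u, hu⟩ := IsAlgClosed.exists_pow_nat_eq ((b + d) / 2) (n := 3) (by norm_num)
  by_cases h0 : u = 0
  · subst h0
    have hb : d = -b := by linear_combination -2 * hu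
    have ha : a = 0 := by
      have : a ^ 3 = 0 := by rw [hb] at hd; linear_combination hd / 4
      exact pow_eq_zero_iff (by norm_num) |>.mp this
    obtain ⟨v, hv⟩ := IsAlgClosed.exists_pow_nat_eq b (n := 3) (by norm_num)
    exact ⟨0, v, by simp [ha], by simp [hv]⟩
  · refine ⟨u, a / u, by field_simp, ?_⟩
    have h3 : u ^ 3 ≠ 0 := pow_ne_zero _ h0
    rw [div_pow]
    field_simp
    have : (u ^ 3) ^ 2 + a ^ 3 = u ^ 3 * b := by
      rw [hu]; linear_combination hd / 4
    linear_combination this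

/-- independence of the six basis elements over the polynomial ring in four variables -/
lemma indep (F0 F1 F2 F3 F4 F5 : MvPolynomial (Fin 4) ℂ)
    (h : ∀ u v s t : ℂ,
      let e := aeval (R := ℂ) ![q / 3 * (u * v), q / 36 * (u ^ 3 + v ^ 3), -4 * q * (s * t),
        4 * (s ^ 3 + t ^ 3)]
      e F0 + e F1 * (u * t + v * s) + e F2 * (-(q / 3) * (u ^ 2 * s + v ^ 2 * t))
        + e F3 * (u * s ^ 2 + v * t ^ 2)
        + e F4 * (u * t + v * s) ^ 2 + e F5 * (u * t + v * s) ^ 3 = 0) :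
    F0 = 0 ∧ F1 = 0 ∧ F2 = 0 ∧ F3 = 0 ∧ F4 = 0 ∧ F5 = 0 := by
  have hq := q_ne
  -- the discriminant
  let D : MvPolynomial (Fin 4) ℂ :=
    ((C (36 / q) * X 1) ^ 2 - 4 * (C (3 / q) * X 0) ^ 3) *
      ((C (1 / 4) * X 3) ^ 2 - 4 * (C (-1 / (4 * q)) * X 2) ^ 3)
  have hD : ∀ u v s t : ℂ, aeval (R := ℂ) ![q / 3 * (u * v), q / 36 * (u ^ 3 + v ^ 3),
      -4 * q * (s * t), 4 * (s ^ 3 + t ^ 3)] D = (u ^ 3 - v ^ 3) ^ 2 * (s ^ 3 - t ^ 3) ^ 2 := by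
    intro u v s t
    simp [D]
    field_simp
    ring
  have hD0 : D ≠ 0 := by
    intro h0
    have := hD 1 0 1 0
    rw [h0] at this
    simp at this
  have main : ∀ x : Fin 4 → ℂ, aeval (R := ℂ) x D ≠ 0 →
      aeval x F0 = 0 ∧ aeval x F1 = 0 ∧ aeval x F2 = 0 ∧ aeval x F3 = 0 ∧ aeval x F4 = 0
        ∧ aeval x F5 = 0 := by
    intro x hx
    obtain ⟨u, v, h1, h2⟩ := exists_uv (x 0 * (3 / q)) (x 1 * (36 / q))
    obtain ⟨s, t, h3, h4⟩ := exists_uv (x 2 * (-1 / (4 * q))) (x 3 * (1 / 4))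
    have hxe : x = ![q / 3 * (u * v), q / 36 * (u ^ 3 + v ^ 3),
      -4 * q * (s * t), 4 * (s ^ 3 + t ^ 3)] := by
      rw [h1, h2, h3, h4]
      ext i
      fin_cases i <;> simp <;> field_simp
    rw [hxe, hD] at hx
    have hx1 : u ^ 3 - v ^ 3 ≠ 0 := fun h => hx (by rw [h]; ring)
    have hx2 : s ^ 3 - t ^ 3 ≠ 0 := fun h => hx (by rw [h]; ring)
    obtain ⟨k0, k1, k2, k3, k4, k5⟩ := indep_pt u v s t (aeval x F0) (aeval x F1)
      (aeval x F2 * (-(q / 3))) (aeval x F3) (aeval x F4) (aeval x F5) (by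
        intro u' v' g1 g2
        have := h u' v' s t
        simp only [g1, g2] at this
        rw [← hxe] at this
        linear_combination this) hx1 hx2
    refine ⟨k0, k1, ?_, k3, k4, k5⟩
    simpa [hq] using k2
  have fin : ∀ F : MvPolynomial (Fin 4) ℂ,
      (∀ x : Fin 4 → ℂ, aeval (R := ℂ) x D ≠ 0 → aeval x F = 0) → F = 0 := by
    intro F hF
    have : F * D = 0 := by
      apply MvPolynomial.funext
      intro x
      by_cases hx : aeval (R := ℂ) x D = 0
      · have : eval x D = 0 := by simpa [aeval_eq_eval] using hx
        simp [this]
      · have : eval x F = 0 := by simpa [aeval_eq_eval] using hF x hx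
        simp [this]
    exact (mul_eq_zero.mp this).resolve_right hD0
  exact ⟨fin _ fun x hx => (main x hx).1, fin _ fun x hx => (main x hx).2.1,
    fin _ fun x hx => (main x hx).2.2.1, fin _ fun x hx => (main x hx).2.2.2.1,
    fin _ fun x hx => (main x hx).2.2.2.2.1, fin _ fun x hx => (main x hx).2.2.2.2.2⟩

section powersums
variable {R : Type*} [CommRing R] [Algebra ℂ R]

/-- polarized power sums -/
def pwr (x y : Fin 3 → R) (a b : ℕ) : R := ∑ i, x i ^ a * y i ^ b

/-- the images of the seven generators -/
def gens (x y : Fin 3 → R) : Fin 7 → R :=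
  ![18 * pwr x y 1 1, 18 * algebraMap ℂ R q * pwr x y 2 0,
    -108 * algebraMap ℂ R q * pwr x y 2 1, 54 * algebraMap ℂ R q * pwr x y 3 0,
    54 * pwr x y 1 2, 36 * pwr x y 0 3, -6 * algebraMap ℂ R q * pwr x y 0 2]

lemma Q_sq : (algebraMap ℂ R q) ^ 2 = -3 := by
  rw [← map_pow, q_sq, map_neg]
  exact congrArg Neg.neg (map_ofNat (algebraMap ℂ R) 3)

lemma gens_rel (x y : Fin 3 → R) (hx : x 0 + x 1 + x 2 = 0) (hy : y 0 + y 1 + y 2 = 0)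
    (v : Fin 7 → R) (hv : v = gens x y) (Q : R) (hQ : Q = algebraMap ℂ R q) :
    (4 * v 0 * v 4 + Q * v 1 * v 5 + v 2 * v 6 = 0) ∧
    (v 0 * v 2 + v 1 * v 4 + Q * v 3 * v 6 = 0) ∧
    (v 0 ^ 2 * v 6 - v 1 * v 6 ^ 2 - 4 * Q * v 4 ^ 2 - 3 * v 2 * v 5 = 0) ∧
    (v 0 ^ 2 * v 1 - v 1 ^ 2 * v 6 - Q * v 2 ^ 2 - 12 * v 3 * v 4 = 0) ∧
    (v 0 ^ 3 - v 0 * v 1 * v 6 + Q * v 2 * v 4 + 3 * Q * v 3 * v 5 = 0) := by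
  have h2 : Q ^ 2 = -3 := by rw [hQ]; exact Q_sq
  have hx2 : x 2 = - x 0 - x 1 := by linear_combination hx
  have hy2 : y 2 = - y 0 - y 1 := by linear_combination hy
  have v0 : v 0 = 18 * pwr x y 1 1 := by rw [hv]; rfl
  have v1 : v 1 = 18 * Q * pwr x y 2 0 := by rw [hv, hQ]; rfl
  have v2 : v 2 = -108 * Q * pwr x y 2 1 := by rw [hv, hQ]; rfl
  have v3 : v 3 = 54 * Q * pwr x y 3 0 := by rw [hv, hQ]; rfl
  have v4 : v 4 = 54 * pwr x y 1 2 := by rw [hv]; rfl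
  have v5 : v 5 = 36 * pwr x y 0 3 := by rw [hv]; rfl
  have v6 : v 6 = -6 * Q * pwr x y 0 2 := by rw [hv, hQ]; rfl
  have r1 : 2 * pwr x y 1 1 * pwr x y 1 2 * 3 =
      3 * pwr x y 2 0 * pwr x y 0 3 + 3 * pwr x y 0 2 * pwr x y 2 1 := by
    simp only [pwr, Fin.sum_univ_three, hx2, hy2]; ring
  have r2 : 2 * pwr x y 1 1 * pwr x y 2 1 =
      pwr x y 2 0 * pwr x y 1 2 + pwr x y 0 2 * pwr x y 3 0 := by
    simp only [pwr, Fin.sum_univ_three, hx2, hy2]; ring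
  have r3 : 6 * (pwr x y 2 1 * pwr x y 0 3 - pwr x y 1 2 ^ 2) =
      pwr x y 0 2 * (pwr x y 1 1 ^ 2 - pwr x y 2 0 * pwr x y 0 2) := by
    simp only [pwr, Fin.sum_univ_three, hx2, hy2]; ring
  have r4 : 6 * (pwr x y 1 2 * pwr x y 3 0 - pwr x y 2 1 ^ 2) =
      pwr x y 2 0 * (pwr x y 1 1 ^ 2 - pwr x y 2 0 * pwr x y 0 2) := by
    simp only [pwr, Fin.sum_univ_three, hx2, hy2]; ring
  have r5 : 3 * (pwr x y 3 0 * pwr x y 0 3 - pwr x y 2 1 * pwr x y 1 2) =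
      pwr x y 1 1 ^ 3 - pwr x y 1 1 * pwr x y 2 0 * pwr x y 0 2 := by
    simp only [pwr, Fin.sum_univ_three, hx2, hy2]; ring
  rw [v0, v1, v2, v3, v4, v5, v6]
  generalize pwr x y 1 1 = p11 at *
  generalize pwr x y 2 0 = p20 at *
  generalize pwr x y 0 2 = p02 at *
  generalize pwr x y 3 0 = p30 at *
  generalize pwr x y 2 1 = p21 at *
  generalize pwr x y 1 2 = p12 at *
  generalize pwr x y 0 3 = p03 at *
  refine ⟨?_, ?_, ?_, ?_, ?_⟩
  · linear_combination (648 * p20 * p03 + 648 * p21 * p02) * h2 + 648 * r1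
  · linear_combination (-324 * Q * p30 * p02) * h2 - 972 * Q * r2
  · linear_combination (-648 * Q * p20 * p02 ^ 2) * h2 + 1944 * Q * r3
  · linear_combination (1944 * Q * p20 ^ 2 * p02 - 11664 * Q * p21 ^ 2) * h2 - 5832 * Q * r4
  · linear_combination (1944 * p11 * p20 * p02 - 5832 * p21 * p12 + 5832 * p30 * p03) * h2
      - 5832 * r5

lemma mem_of_mul (S : Subalgebra ℂ R) {c : ℂ} (hc : c ≠ 0) {r : R}
    (h : algebraMap ℂ R c * r ∈ S) : r ∈ S := by
  have := S.smul_mem h c⁻¹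
  rwa [Algebra.smul_def, ← mul_assoc, ← map_mul, inv_mul_cancel₀ hc, map_one, one_mul] at this

lemma mem_six (S : Subalgebra ℂ R) {r : R} (h : 6 * r ∈ S) : r ∈ S := by
  apply mem_of_mul S (c := 6) (by norm_num)
  rwa [map_ofNat]

lemma pwr_mem (S : Subalgebra ℂ R) (x y : Fin 3 → R) (hx : x 0 + x 1 + x 2 = 0)
    (hy : y 0 + y 1 + y 2 = 0) (hg : ∀ i, gens x y i ∈ S) :
    ∀ n a b : ℕ, a + b = n → pwr x y a b ∈ S := by
  have hx2 : x 2 = - x 0 - x 1 := by linear_combination hx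
  have hy2 : y 2 = - y 0 - y 1 := by linear_combination hy
  have hq := q_ne
  have h11 : pwr x y 1 1 ∈ S := by
    apply mem_of_mul S (c := 18) (by norm_num)
    rw [map_ofNat]; exact hg 0
  have h20 : pwr x y 2 0 ∈ S := by
    apply mem_of_mul S (c := 18 * q) (by simp [hq])
    rw [map_mul, map_ofNat]; exact hg 1
  have h21 : pwr x y 2 1 ∈ S := by
    apply mem_of_mul S (c := -108 * q) (by simp [hq])
    rw [map_mul, map_neg, map_ofNat]; exact hg 2
  have h30 : pwr x y 3 0 ∈ S := by
    apply mem_of_mul S (c := 54 * q) (by simp [hq])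
    rw [map_mul, map_ofNat]; exact hg 3
  have h12 : pwr x y 1 2 ∈ S := by
    apply mem_of_mul S (c := 54) (by norm_num)
    rw [map_ofNat]; exact hg 4
  have h03 : pwr x y 0 3 ∈ S := by
    apply mem_of_mul S (c := 36) (by norm_num)
    rw [map_ofNat]; exact hg 5
  have h02 : pwr x y 0 2 ∈ S := by
    apply mem_of_mul S (c := -6 * q) (by simp [hq])
    rw [map_mul, map_neg, map_ofNat]; exact hg 6
  have n2 : (2 : R) ∈ S := ofNat_mem S 2
  have n3 : (3 : R) ∈ S := ofNat_mem S 3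
  have cx : ∀ i, 6 * x i ^ 3 = 3 * pwr x y 2 0 * x i + 2 * pwr x y 3 0 := by
    intro i
    fin_cases i <;> simp [pwr, Fin.sum_univ_three, hx2] <;> ring
  have cy : ∀ i, 6 * y i ^ 3 = 3 * pwr x y 0 2 * y i + 2 * pwr x y 0 3 := by
    intro i
    fin_cases i <;> simp [pwr, Fin.sum_univ_three, hy2] <;> ring
  intro n
  induction n using Nat.strong_induction_on with
  | _ n ih =>
  intro a b hab
  by_cases ha : 3 ≤ a
  · obtain ⟨c, rfl⟩ := Nat.exists_eq_add_of_le ha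
    have k1 := ih (c + 1 + b) (by omega) (c + 1) b rfl
    have k2 := ih (c + b) (by omega) c b rfl
    apply mem_six
    have : 6 * pwr x y (3 + c) b =
        3 * pwr x y 2 0 * pwr x y (c + 1) b + 2 * pwr x y 3 0 * pwr x y c b := by
      conv_lhs => rw [pwr]
      rw [show pwr x y (c + 1) b = ∑ i, x i ^ (c + 1) * y i ^ b from rfl,
        show pwr x y c b = ∑ i, x i ^ c * y i ^ b from rfl, Finset.mul_sum, Finset.mul_sum,
        Finset.mul_sum, ← Finset.sum_add_distrib]
      refine Finset.sum_congr rfl fun i _ => ?_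
      linear_combination (x i ^ c * y i ^ b) * cx i
    rw [this]
    exact S.add_mem (S.mul_mem (S.mul_mem n3 h20) k1) (S.mul_mem (S.mul_mem n2 h30) k2)
  by_cases hb : 3 ≤ b
  · obtain ⟨c, rfl⟩ := Nat.exists_eq_add_of_le hb
    have k1 := ih (a + (c + 1)) (by omega) a (c + 1) rfl
    have k2 := ih (a + c) (by omega) a c rfl
    apply mem_six
    have : 6 * pwr x y a (3 + c) =
        3 * pwr x y 0 2 * pwr x y a (c + 1) + 2 * pwr x y 0 3 * pwr x y a c := by
      conv_lhs => rw [pwr]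
      rw [show pwr x y a (c + 1) = ∑ i, x i ^ a * y i ^ (c + 1) from rfl,
        show pwr x y a c = ∑ i, x i ^ a * y i ^ c from rfl, Finset.mul_sum, Finset.mul_sum,
        Finset.mul_sum, ← Finset.sum_add_distrib]
      refine Finset.sum_congr rfl fun i _ => ?_
      linear_combination (x i ^ a * y i ^ c) * cy i
    rw [this]
    exact S.add_mem (S.mul_mem (S.mul_mem n3 h02) k1) (S.mul_mem (S.mul_mem n2 h03) k2)
  have h00 : pwr x y 0 0 ∈ S := by
    have : pwr x y 0 0 = 3 := by simp [pwr]
    rw [this]; exact n3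
  have h10 : pwr x y 1 0 ∈ S := by
    have : pwr x y 1 0 = 0 := by simp [pwr, Fin.sum_univ_three, hx2]
    rw [this]; exact S.zero_mem
  have h01 : pwr x y 0 1 ∈ S := by
    have : pwr x y 0 1 = 0 := by simp [pwr, Fin.sum_univ_three, hy2]
    rw [this]; exact S.zero_mem
  have h22 : pwr x y 2 2 ∈ S := by
    apply mem_six
    have : 6 * pwr x y 2 2 = pwr x y 2 0 * pwr x y 0 2 + 2 * pwr x y 1 1 ^ 2 := by
      simp only [pwr, Fin.sum_univ_three, hx2, hy2]; ring
    rw [this]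
    exact S.add_mem (S.mul_mem h20 h02) (S.mul_mem n2 (S.pow_mem h11 2))
  have ha' : a < 3 := by omega
  have hb' : b < 3 := by omega
  interval_cases a <;> interval_cases b <;> assumption

/-- symmetrized products of three functions are polynomials in power sums -/
lemma symm_mem (S : Subalgebra ℂ R) (x y : Fin 3 → R) (h : ∀ a b, pwr x y a b ∈ S)
    (a b : Fin 3 → ℕ) (g : Fin 3 → Fin 3 → R) (hg : ∀ i j, g i j = x j ^ a i * y j ^ b i) :
    g 0 0 * g 1 1 * g 2 2 + g 0 1 * g 1 0 * g 2 2 + g 0 2 * g 1 1 * g 2 0 + g 0 0 * g 1 2 * g 2 1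
      + g 0 1 * g 1 2 * g 2 0 + g 0 2 * g 1 0 * g 2 1 ∈ S := by
  have e1 : ∀ i, ∑ j, g i j ∈ S := fun i => by
    have := h (a i) (b i)
    simpa only [pwr, hg] using this
  have e2 : ∀ i k, ∑ j, g i j * g k j ∈ S := fun i k => by
    have := h (a i + a k) (b i + b k)
    convert this using 1
    rw [pwr]
    refine Finset.sum_congr rfl fun j _ => ?_
    rw [hg, hg]; ring
  have e3 : ∑ j, g 0 j * g 1 j * g 2 j ∈ S := by
    have := h (a 0 + a 1 + a 2) (b 0 + b 1 + b 2)
    convert this using 1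
    rw [pwr]
    refine Finset.sum_congr rfl fun j _ => ?_
    rw [hg, hg, hg]; ring
  have t1 := S.mul_mem (S.mul_mem (e1 0) (e1 1)) (e1 2)
  have t2 := S.add_mem (S.add_mem (S.mul_mem (e2 0 1) (e1 2)) (S.mul_mem (e2 0 2) (e1 1)))
    (S.mul_mem (e2 1 2) (e1 0))
  have t3 := S.mul_mem (ofNat_mem S 2) e3
  have t := S.add_mem (S.sub_mem t1 t2) t3
  convert t using 1
  simp only [Fin.sum_univ_three]
  ring
end powersums

/-- the quotient map onto `A` -/
def mkA : MvPolynomial (Fin 3 × Fin 2) ℂ →ₐ[ℂ] A := Ideal.Quotient.mkₐ ℂ _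

/-- the quotient map onto `R₃` -/
def mkR : MvPolynomial (Fin 7) ℂ →ₐ[ℂ] R₃ := Ideal.Quotient.mkₐ ℂ _

lemma mkA_surj : Function.Surjective mkA := Ideal.Quotient.mkₐ_surjective ℂ _
lemma mkR_surj : Function.Surjective mkR := Ideal.Quotient.mkₐ_surjective ℂ _

/-- coordinates on `A` -/
def xA (i : Fin 3) : A := mkA (X (i, 0))
/-- coordinates on `A` -/
def yA (i : Fin 3) : A := mkA (X (i, 1))

lemma xA_sum : xA 0 + xA 1 + xA 2 = 0 := by
  have : mkA (∑ i : Fin 3, X (i, (0 : Fin 2))) = 0 :=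
    Ideal.Quotient.eq_zero_iff_mem.mpr (Ideal.subset_span (by simp))
  rw [Fin.sum_univ_three, map_add, map_add] at this
  exact this

lemma yA_sum : yA 0 + yA 1 + yA 2 = 0 := by
  have : mkA (∑ i : Fin 3, X (i, (1 : Fin 2))) = 0 :=
    Ideal.Quotient.eq_zero_iff_mem.mpr (Ideal.subset_span (by simp))
  rw [Fin.sum_univ_three, map_add, map_add] at this
  exact this

/-- evaluation at a point of `𝔥₃ ⊕ 𝔥₃*` -/
lemma exists_eval (x y : Fin 3 → ℂ) (hx : x 0 + x 1 + x 2 = 0) (hy : y 0 + y 1 + y 2 = 0) :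
    ∃ e : A →ₐ[ℂ] ℂ, (∀ i, e (xA i) = x i) ∧ (∀ i, e (yA i) = y i) := by
  let e0 : MvPolynomial (Fin 3 × Fin 2) ℂ →ₐ[ℂ] ℂ := aeval fun k => ![x k.1, y k.1] k.2
  have h0 : ∀ a ∈ (Ideal.span {∑ i : Fin 3, X (i, (0 : Fin 2)), ∑ i : Fin 3, X (i, (1 : Fin 2))} :
      Ideal (MvPolynomial (Fin 3 × Fin 2) ℂ)), e0 a = 0 := by
    intro a ha
    have : Ideal.span {∑ i : Fin 3, X (i, (0 : Fin 2)), ∑ i : Fin 3, X (i, (1 : Fin 2))} ≤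
        RingHom.ker e0.toRingHom := by
      rw [Ideal.span_le]
      rintro p (rfl | rfl)
      · simpa [e0, RingHom.mem_ker, Fin.sum_univ_three] using hx
      · simpa [e0, RingHom.mem_ker, Fin.sum_univ_three] using hy
    exact this ha
  let e : A →ₐ[ℂ] ℂ := Ideal.Quotient.liftₐ _ e0 h0
  have he : ∀ p, e (mkA p) = e0 p := fun p => rfl
  refine ⟨e, fun i => ?_, fun i => ?_⟩
  · rw [xA, he]; simp [e0]
  · rw [yA, he]; simp [e0]

lemma exists_psi (v : Fin 7 → A) (Q : A) (hQ : Q = algebraMap ℂ A q)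
    (e1 : 4 * v 0 * v 4 + Q * v 1 * v 5 + v 2 * v 6 = 0)
    (e2 : v 0 * v 2 + v 1 * v 4 + Q * v 3 * v 6 = 0)
    (e3 : v 0 ^ 2 * v 6 - v 1 * v 6 ^ 2 - 4 * Q * v 4 ^ 2 - 3 * v 2 * v 5 = 0)
    (e4 : v 0 ^ 2 * v 1 - v 1 ^ 2 * v 6 - Q * v 2 ^ 2 - 12 * v 3 * v 4 = 0)
    (e5 : v 0 ^ 3 - v 0 * v 1 * v 6 + Q * v 2 * v 4 + 3 * Q * v 3 * v 5 = 0) :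
    ∃ ψ : R₃ →ₐ[ℂ] A, ∀ p, ψ (mkR p) = aeval v p := by
  have h0 : ∀ a ∈ Jideal, (aeval v : MvPolynomial (Fin 7) ℂ →ₐ[ℂ] A) a = 0 := by
    intro a ha
    have : Jideal ≤ RingHom.ker (aeval v : MvPolynomial (Fin 7) ℂ →ₐ[ℂ] A).toRingHom := by
      rw [Jideal, Ideal.span_le]
      rintro p (rfl | rfl | rfl | rfl | rfl) <;>
        simp only [SetLike.mem_coe, RingHom.mem_ker, AlgHom.toRingHom_eq_coe, RingHom.coe_coe,
          map_add, map_sub, map_mul, map_pow, map_ofNat, aeval_X, algHom_C, ← hQ] <;>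
        assumption
    exact this ha
  exact ⟨Ideal.Quotient.liftₐ _ (aeval v) h0, fun p => rfl⟩

lemma mkR_rel :
    let v : Fin 7 → R₃ := fun i => mkR (X i)
    let Q : R₃ := algebraMap ℂ R₃ q
    (4 * v 0 * v 4 + Q * v 1 * v 5 + v 2 * v 6 = 0) ∧
    (v 0 * v 2 + v 1 * v 4 + Q * v 3 * v 6 = 0) ∧
    (v 0 ^ 2 * v 6 - v 1 * v 6 ^ 2 - 4 * Q * v 4 ^ 2 - 3 * v 2 * v 5 = 0) ∧
    (v 0 ^ 2 * v 1 - v 1 ^ 2 * v 6 - Q * v 2 ^ 2 - 12 * v 3 * v 4 = 0) ∧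
    (v 0 ^ 3 - v 0 * v 1 * v 6 + Q * v 2 * v 4 + 3 * Q * v 3 * v 5 = 0) := by
  intro v Q
  have hz : ∀ p ∈ Jideal, mkR p = 0 := fun p hp => Ideal.Quotient.eq_zero_iff_mem.mpr hp
  have z1 := hz _ (Ideal.subset_span (Set.mem_insert _ _))
  have z2 := hz _ (Ideal.subset_span (Set.mem_insert_of_mem _ (Set.mem_insert _ _)))
  have z3 := hz _ (Ideal.subset_span (Set.mem_insert_of_mem _ (Set.mem_insert_of_mem _
    (Set.mem_insert _ _))))
  have z4 := hz _ (Ideal.subset_span (Set.mem_insert_of_mem _ (Set.mem_insert_of_mem _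
    (Set.mem_insert_of_mem _ (Set.mem_insert _ _)))))
  have z5 := hz _ (Ideal.subset_span (Set.mem_insert_of_mem _ (Set.mem_insert_of_mem _
    (Set.mem_insert_of_mem _ (Set.mem_insert_of_mem _ (Set.mem_singleton _))))))
  simp only [map_add, map_sub, map_mul, map_pow, map_ofNat, algHom_C] at z1 z2 z3 z4 z5
  exact ⟨z1, z2, z3, z4, z5⟩

lemma gens_map {R R' : Type*} [CommRing R] [Algebra ℂ R] [CommRing R'] [Algebra ℂ R']
    (e : R →ₐ[ℂ] R') (x y : Fin 3 → R) (i : Fin 7) :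
    e (gens x y i) = gens (fun j => e (x j)) (fun j => e (y j)) i := by
  have hp : ∀ a b, e (pwr x y a b) = pwr (fun j => e (x j)) (fun j => e (y j)) a b := by
    intro a b
    simp only [pwr, map_sum, map_mul, map_pow]
  fin_cases i <;>
    simp [gens, hp, map_mul, map_neg, map_ofNat]

lemma gens_perm {R : Type*} [CommRing R] [Algebra ℂ R] (x y : Fin 3 → R)
    (σ : Equiv.Perm (Fin 3)) : gens (fun j => x (σ j)) (fun j => y (σ j)) = gens x y := by
  have hp : ∀ a b, pwr (fun j => x (σ j)) (fun j => y (σ j)) a b = pwr x y a b := fun a b =>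
    Equiv.sum_comp σ (fun i => x i ^ a * y i ^ b)
  simp only [gens, hp]

/-- values of the generators at the points parametrized by `u, v, s, t` -/
lemma gens_pt (u v s t : ℂ) :
    gens (R := ℂ) ![(u + v) / 18, (ω * u + ω ^ 2 * v) / 18, (ω ^ 2 * u + ω * v) / 18]
      ![(s + t) / 3, (ω * s + ω ^ 2 * t) / 3, (ω ^ 2 * s + ω * t) / 3] =
    ![u * t + v * s, q / 3 * (u * v), -(q / 3) * (u ^ 2 * s + v ^ 2 * t),
      q / 36 * (u ^ 3 + v ^ 3), u * s ^ 2 + v * t ^ 2, 4 * (s ^ 3 + t ^ 3),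
      -4 * q * (s * t)] := by
  have hw : ω ^ 2 = -ω - 1 := by linear_combination omega_rel
  have w3 : ω ^ 3 = 1 := by linear_combination (ω - 1) * omega_rel
  have w4 : ω ^ 4 = ω := by linear_combination ω * w3
  have w5 : ω ^ 5 = -ω - 1 := by linear_combination ω ^ 2 * w3 + hw
  have w6 : ω ^ 6 = 1 := by linear_combination (ω ^ 3 + 1) * w3
  ext i
  fin_cases i <;> simp [gens, pwr, Fin.sum_univ_three] <;> ring_nf <;>
    simp only [hw, w3, w4, w5, w6] <;> ring

lemma psi_inj (ψ : R₃ →ₐ[ℂ] A) (hψ : ∀ p, ψ (mkR p) = aeval (gens xA yA) p) :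
    Function.Injective ψ := by
  rw [injective_iff_map_eq_zero]
  intro r hr
  obtain ⟨p, rfl⟩ := mkR_surj r
  obtain ⟨e1, e2, e3, e4, e5⟩ := mkR_rel
  obtain ⟨F0, F1, F2, F3, F4, F5, hF⟩ :=
    span_all (fun i => mkR (X i)) _ rfl e1 e2 e3 e4 e5 p
  have hp : aeval (fun i => mkR (X i)) p = mkR p := by
    rw [← comp_aeval_apply, aeval_X_left_apply]
  rw [hp] at hF
  have hψX : ∀ i, ψ (mkR (X i)) = gens xA yA i := fun i => by rw [hψ, aeval_X]
  have key := indep F0 F1 F2 F3 F4 F5 (by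
    intro u v s t
    have w := omega_rel
    obtain ⟨e, hx, hy⟩ := exists_eval
      ![(u + v) / 18, (ω * u + ω ^ 2 * v) / 18, (ω ^ 2 * u + ω * v) / 18]
      ![(s + t) / 3, (ω * s + ω ^ 2 * t) / 3, (ω ^ 2 * s + ω * t) / 3]
      (by simp; linear_combination (u + v) / 18 * w) (by simp; linear_combination (s + t) / 3 * w)
    have hX : ∀ i, (e.comp ψ) (mkR (X i)) = ![u * t + v * s, q / 3 * (u * v),
        -(q / 3) * (u ^ 2 * s + v ^ 2 * t),
        q / 36 * (u ^ 3 + v ^ 3), u * s ^ 2 + v * t ^ 2, 4 * (s ^ 3 + t ^ 3),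
        -4 * q * (s * t)] i := by
      intro i
      rw [AlgHom.comp_apply, hψX, gens_map, ← gens_pt]
      congr 1
      congr 1
      · funext j; exact hx j
      · funext j; exact hy j
    have hφ : ∀ F : MvPolynomial (Fin 4) ℂ,
        (e.comp ψ) (aeval ![mkR (X 1), mkR (X 3), mkR (X 6), mkR (X 5)] F) =
        aeval (R := ℂ) ![q / 3 * (u * v), q / 36 * (u ^ 3 + v ^ 3), -4 * q * (s * t),
          4 * (s ^ 3 + t ^ 3)] F := by
      intro F
      rw [comp_aeval_apply]
      congr 2
      funext j
      fin_cases j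
      · exact hX 1
      · exact hX 3
      · exact hX 6
      · exact hX 5
    have h0 : (e.comp ψ) (mkR p) = 0 := by rw [AlgHom.comp_apply, hr, map_zero]
    rw [hF] at h0
    simp only [map_add, map_mul, map_pow, hφ] at h0
    rw [hX 0, hX 2, hX 4] at h0
    exact h0)
  obtain ⟨rfl, rfl, rfl, rfl, rfl, rfl⟩ := key
  rw [hF]
  simp

theorem chart_R3_is_A2_singularity
    (ρ : Equiv.Perm (Fin 3) → (A ≃ₐ[ℂ] A))
    (hρ : ∀ (σ : Equiv.Perm (Fin 3)) (i : Fin 3) (j : Fin 2),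
      ρ σ (Ideal.Quotient.mk _ (X (i, j))) = Ideal.Quotient.mk _ (X (σ i, j))) :
    ∃ ψ : R₃ →ₐ[ℂ] A, Function.Injective ψ ∧
      Set.range ψ = {a : A | ∀ σ : Equiv.Perm (Fin 3), ρ σ a = a} := by
  have hρx : ∀ σ i, ρ σ (xA i) = xA (σ i) := fun σ i => hρ σ i 0
  have hρy : ∀ σ i, ρ σ (yA i) = yA (σ i) := fun σ i => hρ σ i 1
  obtain ⟨e1, e2, e3, e4, e5⟩ := gens_rel xA yA xA_sum yA_sum _ rfl _ rfl
  obtain ⟨ψ, hψ⟩ := exists_psi (gens xA yA) _ rfl e1 e2 e3 e4 e5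
  refine ⟨ψ, psi_inj ψ hψ, ?_⟩
  have hψX : ∀ i, ψ (mkR (X i)) = gens xA yA i := fun i => by rw [hψ, aeval_X]
  apply Set.Subset.antisymm
  · rintro _ ⟨r, rfl⟩ σ
    obtain ⟨p, rfl⟩ := mkR_surj r
    rw [hψ]
    change ((ρ σ : A ≃ₐ[ℂ] A) : A →ₐ[ℂ] A) (aeval (gens xA yA) p) = aeval (gens xA yA) p
    rw [comp_aeval_apply]
    congr 2
    funext i
    rw [gens_map, ← gens_perm xA yA σ]
    congr 1
    congr 1
    · funext j; exact hρx σ j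
    · funext j; exact hρy σ j
  · intro a ha
    have hS := pwr_mem ψ.range xA yA xA_sum yA_sum (fun i => ⟨mkR (X i), hψX i⟩)
    have rey : ∀ a : A, ρ 1 a + ρ (Equiv.swap 0 1) a + ρ (Equiv.swap 0 2) a
        + ρ (Equiv.swap 1 2) a + ρ (Equiv.swap 0 2 * Equiv.swap 0 1) a
        + ρ (Equiv.swap 0 1 * Equiv.swap 0 2) a ∈ ψ.range := by
      intro a
      obtain ⟨p, rfl⟩ := mkA_surj a
      induction p using MvPolynomial.induction_on' with
      | add p r hp hr =>
        have := ψ.range.add_mem hp hr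
        convert this using 1
        simp only [map_add]
        ring
      | monomial m c =>
        have hm : mkA (monomial m c) = algebraMap ℂ A c *
            ((xA 0 ^ m (0, 0) * yA 0 ^ m (0, 1)) * (xA 1 ^ m (1, 0) * yA 1 ^ m (1, 1)) *
              (xA 2 ^ m (2, 0) * yA 2 ^ m (2, 1))) := by
          rw [monomial_eq, map_mul, algHom_C,
            Finsupp.prod_fintype _ _ (fun _ => pow_zero _), Fintype.prod_prod_type]
          simp only [Fin.prod_univ_three, Fin.prod_univ_two, map_mul, map_pow]
          rfl
        have := ψ.range.mul_mem (ψ.range.algebraMap_mem c)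
          (symm_mem ψ.range xA yA (fun a b => hS _ a b rfl) (fun i => m (i, 0))
            (fun i => m (i, 1)) _ (fun i j => rfl))
        rw [hm]
        simp only [map_mul, map_pow, AlgEquiv.commutes, hρx, hρy]
        convert this using 1
        simp only [show ∀ i, (1 : Equiv.Perm (Fin 3)) i = i from fun _ => rfl,
          show (Equiv.swap (0 : Fin 3) 1) 0 = 1 by decide,
          show (Equiv.swap (0 : Fin 3) 1) 1 = 0 by decide,
          show (Equiv.swap (0 : Fin 3) 1) 2 = 2 by decide,
          show (Equiv.swap (0 : Fin 3) 2) 0 = 2 by decide,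
          show (Equiv.swap (0 : Fin 3) 2) 1 = 1 by decide,
          show (Equiv.swap (0 : Fin 3) 2) 2 = 0 by decide,
          show (Equiv.swap (1 : Fin 3) 2) 0 = 0 by decide,
          show (Equiv.swap (1 : Fin 3) 2) 1 = 2 by decide,
          show (Equiv.swap (1 : Fin 3) 2) 2 = 1 by decide, Equiv.Perm.mul_apply]
        ring
    have h := rey a
    have ha2 : ∀ σ, ρ σ a = a := ha
    simp only [ha2] at h
    obtain ⟨r, hr⟩ := mem_six ψ.range (r := a) (by convert h using 1; ring)
    exact ⟨r, hr⟩

end
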